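/- Let d≥2, β>-1/2, γ>-1, n∈ℕ₀, ξ,η∈𝕊^{d-1} and t,s∈(0,1]. Then P_n(ϖ_{β,γ};(√t·ξ,t),(√s·η,s)) = τ_β·∫_{-1}^1∫_{-1}^1 P_n(U_{γ,β+(d-1)/2};(√t,t),(√s·(((1-z₁)/2)⟨ξ,η⟩ + ((1+z₁)/2)z₂), s))·(1-z₁)^{(d-2)/2}(1+z₁)^{β-1/2}(1-z₂²)^β dz₁ dz₂, where τ_β = (∫_{-1}^1∫_{-1}^1 (1-z₁)^{(d-2)/2}(1+z₁)^{β-1/2}(1-z₂²)^β dz₁ dz₂)^{-1}. -/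

import Mathlib

open MeasureTheory Real Filter Set
open scoped RealInnerProductSpace ENNReal

noncomputable section

/-- Pochhammer symbol `(a)_n = a(a+1)⋯(a+n-1)`. -/
def poch (a : ℝ) (n : ℕ) : ℝ := ∏ i ∈ Finset.range n, (a + i)

/-- Jacobi polynomial `P_n^{(a,b)}(t)` via its hypergeometric expansion. -/
def jacobiP (n : ℕ) (a b : ℝ) (t : ℝ) : ℝ :=
  (poch (a + 1) n / (n.factorial : ℝ)) *
    ∑ j ∈ Finset.range (n + 1),
      (poch (-(n : ℝ)) j * poch ((n : ℝ) + a + b + 1) j) /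
        (poch (a + 1) j * (j.factorial : ℝ)) * ((1 - t) / 2) ^ j

/-- Squared norm `h_n^{(a,b)}` of the Jacobi polynomials. -/
def hJ (n : ℕ) (a b : ℝ) : ℝ :=
  (poch (a + 1) n * poch (b + 1) n * (a + b + (n : ℝ) + 1)) /
    ((n.factorial : ℝ) * poch (a + b + 2) n * (a + b + 2 * (n : ℝ) + 1))

/-- Normalization constant `c_{a,b}` of the Jacobi weight. -/
def cJ (a b : ℝ) : ℝ := Real.Gamma (a + b + 2) / (Real.Gamma (a + 1) * Real.Gamma (b + 1))

/-- Generalized binomial coefficient `C(n+δ, n) = (δ+1)_n/n!`. -/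
def binomC (δ : ℝ) (n : ℕ) : ℝ := poch (δ + 1) n / (n.factorial : ℝ)

/-- The parabolic domain `𝕌 = {(x₁,x₂) : x₁² ≤ x₂ ≤ 1}`. -/
def Udom : Set (ℝ × ℝ) := {x | x.1 ^ 2 ≤ x.2 ∧ x.2 ≤ 1}

/-- The curved part `𝕌₀` of the boundary of `𝕌`. -/
def Udom0 : Set (ℝ × ℝ) := {x ∈ Udom | x.2 = x.1 ^ 2}

/-- The weight `U_{a,b}` on the parabolic domain. -/
def Uw (a b : ℝ) (x : ℝ × ℝ) : ℝ := (1 - x.2) ^ a * (x.2 - x.1 ^ 2) ^ (b - 1/2)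

/-- Normalization constant `d_{a,b}` of `U_{a,b}`. -/
def dU (a b : ℝ) : ℝ := (∫ x in Udom, Uw a b x)⁻¹

/-- The weighted measure `U_{a,b}(x) dx` on `𝕌`. -/
def μU (a b : ℝ) : Measure (ℝ × ℝ) :=
  (volume.restrict Udom).withDensity fun x => ENNReal.ofReal (Uw a b x)

/-- The orthogonal basis `P_{k,n}^{a,b}` on the parabolic domain (with the continuous
extension to `x₂ = 0`, where in Lean `x₁/√x₂ = 0` and `(√x₂)^k = 0` for `k ≥ 1`). -/
def PknU (a b : ℝ) (k n : ℕ) (x : ℝ × ℝ) : ℝ :=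
  jacobiP (n - k) (b + (k : ℝ)) a (1 - 2 * x.2) * (Real.sqrt x.2) ^ k *
    jacobiP k (b - 1/2) (b - 1/2) (x.1 / Real.sqrt x.2)

/-- Squared norms `h_{k,n}^{a,b}`. -/
def hknU (a b : ℝ) (k n : ℕ) : ℝ :=
  (cJ b a / cJ (b + (k : ℝ)) a) * hJ (n - k) (b + (k : ℝ)) a * hJ k (b - 1/2) (b - 1/2)

/-- Reproducing kernel `P_n(U_{a,b}; x, y)` on the parabolic domain. -/
def PnU (a b : ℝ) (n : ℕ) (x y : ℝ × ℝ) : ℝ :=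
  ∑ k ∈ Finset.range (n + 1), PknU a b k n x * PknU a b k n y / hknU a b k n

/-- Partial-sum kernel `K_n(U_{a,b}; x, y)`. -/
def KnU (a b : ℝ) (n : ℕ) (x y : ℝ × ℝ) : ℝ :=
  ∑ m ∈ Finset.range (n + 1), PnU a b m x y

/-- Cesàro `(C,δ)` kernel `K_n^δ(U_{a,b}; x, y)`. -/
def KnUCes (a b δ : ℝ) (n : ℕ) (x y : ℝ × ℝ) : ℝ :=
  (binomC δ n)⁻¹ * ∑ m ∈ Finset.range (n + 1), binomC (δ - 1) (n - m) * KnU a b m x y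

/-- Cesàro `(C,δ)` means `S_n^δ(U_{a,b}; f, x)`. -/
def SnUCes (a b δ : ℝ) (n : ℕ) (f : ℝ × ℝ → ℝ) (x : ℝ × ℝ) : ℝ :=
  dU a b * ∫ y in Udom, f y * KnUCes a b δ n x y * Uw a b y

/-- `Z_m^λ`, the normalized Gegenbauer polynomial (`2T_m` in the limiting case `λ = 0`). -/
def Zm (lam : ℝ) (m : ℕ) (t : ℝ) : ℝ :=
  if lam = 0 then (if m = 0 then 1 else 2 * (Polynomial.Chebyshev.T ℝ (m : ℤ)).eval t)
  else ((m : ℝ) + lam) / lam * (poch (2 * lam) m / poch (lam + 1/2) m) *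
    jacobiP m (lam - 1/2) (lam - 1/2) t

/-- Euclidean space `ℝ^d`. -/
abbrev Euc (d : ℕ) := EuclideanSpace ℝ (Fin d)

/-- The surface measure on the unit sphere `𝕊^{d-1}`. -/
def sphMeas (d : ℕ) : Measure (Metric.sphere (0 : Euc d) 1) :=
  (volume : Measure (Euc d)).toSphere

/-- The surface area `ω_d` of the unit sphere. -/
def ωd (d : ℕ) : ℝ := (sphMeas d Set.univ).toReal

/-- Integral over the unit sphere. -/
def sphInt (d : ℕ) (f : Euc d → ℝ) : ℝ := ∫ ξ, f (ξ : Euc d) ∂(sphMeas d)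

/-- Integral over the surface of the paraboloid `𝕍₀^{d+1}`:
`∫_{𝕍₀} f dσ = ∫_0^1 t^{(d-1)/2} ∫_{𝕊^{d-1}} f(√t ξ, t) dσ_𝕊(ξ) dt`. -/
def V0Int (d : ℕ) (f : Euc d → ℝ → ℝ) : ℝ :=
  ∫ t in (0:ℝ)..1, t ^ (((d : ℝ) - 1) / 2) * ∫ ξ, f (Real.sqrt t • (ξ : Euc d)) t ∂(sphMeas d)

/-- The weight `ϖ_{β,γ}(t) = t^β (1-t)^γ`. -/
def wt (β γ : ℝ) (t : ℝ) : ℝ := t ^ β * (1 - t) ^ γ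

/-- Normalization constant `b_{β,γ}` on the surface of the paraboloid. -/
def bV0 (d : ℕ) (β γ : ℝ) : ℝ := (V0Int d fun _ t => wt β γ t)⁻¹

/-- The surface of the paraboloid `𝕍₀^{d+1} = {(x,t) : ‖x‖² = t ≤ 1}`. -/
def V0set (d : ℕ) : Set (Euc d × ℝ) := {q | ‖q.1‖ ^ 2 = q.2 ∧ q.2 ≤ 1}

/-- The weighted measure `ϖ_{β,γ} dσ` on (the sphere-parametrization of) `𝕍₀^{d+1}`. -/
def μV0 (d : ℕ) (β γ : ℝ) : Measure (Metric.sphere (0 : Euc d) 1 × ℝ) :=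
  ((sphMeas d).prod (volume.restrict (Set.Icc (0:ℝ) 1))).withDensity
    fun p => ENNReal.ofReal (p.2 ^ (((d : ℝ) - 1) / 2) * wt β γ p.2)

/-- Squared norms `h_{m,n}^{β,γ}` on the surface of the paraboloid. -/
def hV0 (d : ℕ) (β γ : ℝ) (m n : ℕ) : ℝ :=
  (cJ (β + ((d : ℝ) - 1) / 2) γ / cJ ((m : ℝ) + β + ((d : ℝ) - 1) / 2) γ) *
    hJ (n - m) ((m : ℝ) + β + ((d : ℝ) - 1) / 2) γ

/-- The reproducing kernel `P_n(ϖ_{β,γ}; (√t ξ, t), (√s η, s))` on `𝕍₀^{d+1}`,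
written as a function of `t`, `s` and `c = ⟨ξ,η⟩`. -/
def PnV0 (d : ℕ) (β γ : ℝ) (n : ℕ) (t s c : ℝ) : ℝ :=
  ∑ m ∈ Finset.range (n + 1),
    jacobiP (n - m) ((m : ℝ) + β + ((d : ℝ) - 1) / 2) γ (1 - 2 * t) *
      jacobiP (n - m) ((m : ℝ) + β + ((d : ℝ) - 1) / 2) γ (1 - 2 * s) / hV0 d β γ m n *
      (Real.sqrt t) ^ m * (Real.sqrt s) ^ m * Zm (((d : ℝ) - 2) / 2) m c

/-- Partial-sum kernel `K_n(ϖ_{β,γ})` on `𝕍₀^{d+1}`. -/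
def KnV0 (d : ℕ) (β γ : ℝ) (n : ℕ) (t s c : ℝ) : ℝ :=
  ∑ m ∈ Finset.range (n + 1), PnV0 d β γ m t s c

/-- Cesàro `(C,δ)` kernel on `𝕍₀^{d+1}`. -/
def KnV0Ces (d : ℕ) (β γ δ : ℝ) (n : ℕ) (t s c : ℝ) : ℝ :=
  (binomC δ n)⁻¹ * ∑ m ∈ Finset.range (n + 1), binomC (δ - 1) (n - m) * KnV0 d β γ m t s c

/-- Cesàro `(C,δ)` means `S_n^δ(ϖ_{β,γ}; f, (√t ξ, t))` on `𝕍₀^{d+1}`. -/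
def SnV0Ces (d : ℕ) (β γ δ : ℝ) (n : ℕ) (f : Euc d × ℝ → ℝ) (ξ : Euc d) (t : ℝ) : ℝ :=
  bV0 d β γ * ∫ s in (0:ℝ)..1, s ^ (((d : ℝ) - 1) / 2) * wt β γ s *
    ∫ η, f (Real.sqrt s • (η : Euc d), s) * KnV0Ces d β γ δ n t s ⟪ξ, (η : Euc d)⟫ ∂(sphMeas d)

/-- Normalization constant `τ_β` in the definition of `T_{β,γ}`. -/
def τβ (d : ℕ) (β : ℝ) : ℝ :=
  (∫ z₁ in (-1:ℝ)..1, ∫ z₂ in (-1:ℝ)..1,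
    (1 - z₁) ^ (((d : ℝ) - 2) / 2) * (1 + z₁) ^ (β - 1/2) * (1 - z₂ ^ 2) ^ β)⁻¹

/-- The operator `T_{β,γ}` on the surface of the paraboloid, with
`(x,t) = (√t ξ, t)` and `(y,s) = (√s η, s)`. -/
def TV0 (d : ℕ) (β γ : ℝ) (g : ℝ × ℝ → ℝ × ℝ → ℝ) (ξ η : Euc d) (t s : ℝ) : ℝ :=
  if β = -(1/2) then g (Real.sqrt t, t) (⟪ξ, Real.sqrt s • η⟫, s)
  else τβ d β * ∫ z₁ in (-1:ℝ)..1, ∫ z₂ in (-1:ℝ)..1,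
    g (Real.sqrt t, t) (Real.sqrt s * ((1 - z₁) / 2 * ⟪ξ, η⟫ + (1 + z₁) / 2 * z₂), s) *
      ((1 - z₁) ^ (((d : ℝ) - 2) / 2) * (1 + z₁) ^ (β - 1/2) * (1 - z₂ ^ 2) ^ β)

/-- The pseudo convolution `f ∗_{𝕍₀} g` on the surface of the paraboloid. -/
def convV0 (d : ℕ) (β γ : ℝ) (f : Euc d × ℝ → ℝ) (g : ℝ × ℝ → ℝ × ℝ → ℝ)
    (η : Euc d) (s : ℝ) : ℝ :=
  bV0 d β γ * ∫ t in (0:ℝ)..1, t ^ (((d : ℝ) - 1) / 2) * wt β γ t *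
    ∫ ξ, f (Real.sqrt t • (ξ : Euc d), t) * TV0 d β γ g (ξ : Euc d) η t s ∂(sphMeas d)

/-- The solid paraboloid `𝕍^{d+1} = {(x,t) : ‖x‖² ≤ t ≤ 1}`. -/
def Vset (d : ℕ) : Set (Euc d × ℝ) := {q | ‖q.1‖ ^ 2 ≤ q.2 ∧ q.2 ≤ 1}

/-- The weight `W_{β,γ,μ}` on the solid paraboloid. -/
def WW (d : ℕ) (β γ μ : ℝ) (q : Euc d × ℝ) : ℝ :=
  q.2 ^ β * (1 - q.2) ^ γ * (q.2 - ‖q.1‖ ^ 2) ^ (μ - 1/2)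

/-- Normalization constant `b_{β,γ,μ}`. -/
def bW (d : ℕ) (β γ μ : ℝ) : ℝ := (∫ q in Vset d, WW d β γ μ q)⁻¹

/-- The weighted measure `W_{β,γ,μ}(x,t) dx dt` on `𝕍^{d+1}`. -/
def μW (d : ℕ) (β γ μ : ℝ) : Measure (Euc d × ℝ) :=
  (volume.restrict (Vset d)).withDensity fun q => ENNReal.ofReal (WW d β γ μ q)

/-- The weight `ϖ_μ(y) = (1-‖y‖²)^{μ-1/2}` on the unit ball. -/
def wB (d : ℕ) (μ : ℝ) (y : Euc d) : ℝ := (1 - ‖y‖ ^ 2) ^ (μ - 1/2)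

/-- Normalization constant `b_μ` of `ϖ_μ` on the unit ball. -/
def bB (d : ℕ) (μ : ℝ) : ℝ := (∫ y in Metric.closedBall (0 : Euc d) 1, wB d μ y)⁻¹

/-- Normalization constant `σ_μ = (∫_{-1}^1 (1-u²)^{μ-1} du)⁻¹`. -/
def σμ (μ : ℝ) : ℝ := (∫ u in (-1:ℝ)..1, (1 - u ^ 2) ^ (μ - 1))⁻¹

/-- `ξ₀(x,t,y,s;u) = (⟨x,y⟩ + u √(t-‖x‖²) √(s-‖y‖²))/√(st)`. -/
def xi0 (d : ℕ) (x : Euc d) (t : ℝ) (y : Euc d) (s : ℝ) (u : ℝ) : ℝ :=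
  (⟪x, y⟫ + u * Real.sqrt (t - ‖x‖ ^ 2) * Real.sqrt (s - ‖y‖ ^ 2)) / Real.sqrt (s * t)

/-- Squared norms `h_{m,n}^{β,γ,μ}` on the solid paraboloid. -/
def hW (d : ℕ) (β γ μ : ℝ) (m n : ℕ) : ℝ :=
  (cJ (β + μ + ((d : ℝ) - 1) / 2) γ / cJ ((m : ℝ) + β + μ + ((d : ℝ) - 1) / 2) γ) *
    hJ (n - m) ((m : ℝ) + β + μ + ((d : ℝ) - 1) / 2) γ

/-- The reproducing kernel `P_n(W_{β,γ,μ}; (x,t), (y,s))` on the solid paraboloid. -/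
def PnW (d : ℕ) (β γ μ : ℝ) (n : ℕ) (x : Euc d) (t : ℝ) (y : Euc d) (s : ℝ) : ℝ :=
  σμ μ * ∫ u in (-1:ℝ)..1,
    (∑ m ∈ Finset.range (n + 1),
      jacobiP (n - m) ((m : ℝ) + β + μ + ((d : ℝ) - 1) / 2) γ (1 - 2 * t) *
        jacobiP (n - m) ((m : ℝ) + β + μ + ((d : ℝ) - 1) / 2) γ (1 - 2 * s) / hW d β γ μ m n *
        (Real.sqrt t) ^ m * (Real.sqrt s) ^ m *
        Zm (μ + ((d : ℝ) - 1) / 2) m (xi0 d x t y s u)) * (1 - u ^ 2) ^ (μ - 1)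

/-- Partial-sum kernel `K_n(W_{β,γ,μ})`. -/
def KnW (d : ℕ) (β γ μ : ℝ) (n : ℕ) (x : Euc d) (t : ℝ) (y : Euc d) (s : ℝ) : ℝ :=
  ∑ m ∈ Finset.range (n + 1), PnW d β γ μ m x t y s

/-- Cesàro `(C,δ)` kernel on the solid paraboloid. -/
def KnWCes (d : ℕ) (β γ μ δ : ℝ) (n : ℕ) (x : Euc d) (t : ℝ) (y : Euc d) (s : ℝ) : ℝ :=
  (binomC δ n)⁻¹ * ∑ m ∈ Finset.range (n + 1), binomC (δ - 1) (n - m) * KnW d β γ μ m x t y s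

/-- Cesàro `(C,δ)` means `S_n^δ(W_{β,γ,μ}; f, (x,t))`. -/
def SnWCes (d : ℕ) (β γ μ δ : ℝ) (n : ℕ) (f : Euc d × ℝ → ℝ) (x : Euc d) (t : ℝ) : ℝ :=
  bW d β γ μ * ∫ q in Vset d, f q * KnWCes d β γ μ δ n x t q.1 q.2 * WW d β γ μ q

/-- `ξ(x,t,y,s;z,u)` in the connection kernel on the solid paraboloid. -/
def ξW (d : ℕ) (x : Euc d) (t : ℝ) (y : Euc d) (s : ℝ) (z₁ z₂ u : ℝ) : ℝ :=
  (1 - z₁) / 2 * xi0 d x t y s u + (1 + z₁) / 2 * z₂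

/-- Normalization constant `κ_β`. -/
def κβ (d : ℕ) (β μ : ℝ) : ℝ :=
  (∫ z₁ in (-1:ℝ)..1, ∫ z₂ in (-1:ℝ)..1, ∫ u in (-1:ℝ)..1,
    (1 - z₁) ^ (μ + ((d : ℝ) - 1) / 2) * (1 + z₁) ^ (β - 1) * (1 - z₂ ^ 2) ^ (β - 1/2) *
      (1 - u ^ 2) ^ (μ - 1))⁻¹

/-- The operator `T_{β,γ,μ}` on the solid paraboloid. -/
def TW (d : ℕ) (β γ μ : ℝ) (g : ℝ × ℝ → ℝ × ℝ → ℝ) (x : Euc d) (t : ℝ) (y : Euc d) (s : ℝ) : ℝ :=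
  if β = 0 then
    σμ μ * ∫ u in (-1:ℝ)..1,
      g (Real.sqrt t, t) (Real.sqrt s * xi0 d x t y s u, s) * (1 - u ^ 2) ^ (μ - 1)
  else
    κβ d β μ * ∫ z₁ in (-1:ℝ)..1, ∫ z₂ in (-1:ℝ)..1, ∫ u in (-1:ℝ)..1,
      g (Real.sqrt t, t) (Real.sqrt s * ξW d x t y s z₁ z₂ u, s) *
        ((1 - z₁) ^ (μ + ((d : ℝ) - 1) / 2) * (1 + z₁) ^ (β - 1) * (1 - z₂ ^ 2) ^ (β - 1/2) *
          (1 - u ^ 2) ^ (μ - 1))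

/-- Directional derivative `⟨x,∇⟩f(x) = ∑ xᵢ ∂ᵢ f(x)`. -/
def xGrad (d : ℕ) (f : Euc d → ℝ) (x : Euc d) : ℝ := fderiv ℝ f x x

/-- Laplacian `Δf(x) = ∑ ∂ᵢ² f(x)`. -/
def lapl (d : ℕ) (f : Euc d → ℝ) (x : Euc d) : ℝ :=
  ∑ i : Fin d, fderiv ℝ (fun y => fderiv ℝ f y (EuclideanSpace.single i 1)) x
    (EuclideanSpace.single i 1)


/-- `Q_{m,n}(x,t) = P_{n-m}^{(m+α,γ)}(1-2t) t^{m/2} Y(x/√t)`. -/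
def QV0gen (d : ℕ) (α γ : ℝ) (m n : ℕ) (Y : Euc d → ℝ) (x : Euc d) (t : ℝ) : ℝ :=
  jacobiP (n - m) ((m : ℝ) + α) γ (1 - 2 * t) * (Real.sqrt t) ^ m * Y ((Real.sqrt t)⁻¹ • x)

end

lemma poch_zero' (a : ℝ) : poch a 0 = 1 := by simp [poch]

lemma poch_succ' (a : ℝ) (n : ℕ) : poch a (n+1) = poch a n * (a + n) := by
  simp [poch, Finset.prod_range_succ]

lemma poch_succ_left (a : ℝ) (n : ℕ) : poch a (n+1) = a * poch (a+1) n := by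
  simp only [poch, Finset.prod_range_succ']
  rw [mul_comm]
  congr 1
  · simp
  · apply Finset.prod_congr rfl
    intros; push_cast; ring

lemma poch_pos' {a : ℝ} (ha : 0 < a) (n : ℕ) : 0 < poch a n :=
  Finset.prod_pos fun i _ => by positivity

lemma poch_add' (a : ℝ) (m n : ℕ) : poch a (m+n) = poch a m * poch (a+m) n := by
  induction n with
  | zero => simp [poch_zero']
  | succ n ih => rw [← add_assoc, poch_succ', ih, poch_succ']; push_cast; ring

lemma poch_dup (a : ℝ) (n : ℕ) : poch (2*a) (2*n) = 4^n * poch a n * poch (a+1/2) n := by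
  induction n with
  | zero => simp [poch_zero']
  | succ n ih =>
    rw [show 2*(n+1) = 2*n+1+1 by ring, poch_succ', poch_succ', ih, poch_succ', poch_succ']
    push_cast; ring

lemma poch_neg (j k : ℕ) : poch (-((j+k : ℕ):ℝ)) j * k.factorial = (-1)^j * (j+k).factorial := by
  induction j generalizing k with
  | zero => simp [poch_zero']
  | succ j ih =>
    have h := ih (k+1)
    rw [poch_succ']
    rw [show j + 1 + k = j + (k+1) by ring, pow_succ]
    rw [Nat.factorial_succ] at h
    push_cast at h ⊢
    linear_combination (-1) * h

/-- auxiliary coefficients -/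
noncomputable def aC : ℕ → ℝ → ℝ
  | 0, _ => 1
  | (j+1), s => s * poch (s+j+2) j / ((j+1).factorial : ℝ)

/-- auxiliary coefficients -/
noncomputable def bC : ℕ → ℝ → ℝ
  | 0, _ => 1
  | (k+1), w => (w + 2*k + 2) * poch (w+1) k / ((k+1).factorial : ℝ)

lemma bC_poch (k : ℕ) (w : ℝ) : poch w k * (w + 2*k) = w * (k.factorial * bC k w) := by
  cases k with
  | zero => simp [poch_zero', bC]
  | succ k =>
    have := (Nat.factorial_pos (k+1)).ne'
    rw [bC, poch_succ_left, mul_div_cancel₀ _ (by exact_mod_cast this)]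
    push_cast; ring

lemma bC_rec (k : ℕ) (w : ℝ) : bC (k+1) (w+1) = bC (k+1) w + bC k (w+1) := by
  cases k with
  | zero => simp [bC, poch_zero']; ring
  | succ k =>
    have h2 : ((k+1).factorial : ℝ) ≠ 0 := by exact_mod_cast (Nat.factorial_pos (k+1)).ne'
    simp only [bC]
    rw [Nat.factorial_succ (k+1), poch_succ', poch_succ_left (w+1)]
    push_cast
    field_simp
    ring

lemma aC_rec (j : ℕ) (s : ℝ) : aC (j+1) (s+1) = aC (j+1) s + aC j (s+2) := by
  cases j with
  | zero => simp [aC, poch_zero']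
  | succ j =>
    have h2 : ((j+1).factorial : ℝ) ≠ 0 := by exact_mod_cast (Nat.factorial_pos (j+1)).ne'
    simp only [aC]
    have e1 : poch (s + 1 + ((j+1:ℕ):ℝ) + 2) (j+1) = poch (s+j+4) j * (s+2*j+4) := by
      rw [poch_succ']; push_cast
      rw [show s + 1 + ((j:ℝ)+1) + 2 = s+j+4 by ring]; ring
    have e2 : poch (s + ((j+1:ℕ):ℝ) + 2) (j+1) = (s+j+3) * poch (s+j+4) j := by
      rw [poch_succ_left]; push_cast
      rw [show s + ((j:ℝ)+1) + 2 + 1 = s+j+4 by ring]; ring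
    have e3 : s + 2 + (j:ℝ) + 2 = s+j+4 := by ring
    rw [e1, e2, e3, Nat.factorial_succ (j+1)]
    push_cast
    field_simp
    ring

lemma aC_zero (j : ℕ) : aC (j+1) 0 = 0 := by simp [aC]

lemma aC_poch (l : ℕ) (s : ℝ) : poch s (2*l) = poch (s+1) l * (l.factorial * aC l s) := by
  cases l with
  | zero => simp [poch_zero', aC]
  | succ j =>
    have := (Nat.factorial_pos (j+1)).ne'
    rw [aC, mul_div_cancel₀ _ (by exact_mod_cast this)]
    rw [show 2*(j+1) = (j+1) + j + 1 by ring, poch_succ_left, poch_add']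
    push_cast
    rw [show s+1+((j:ℝ)+1) = s+j+2 by ring]; ring

/-- polynomial dependence -/
def IsPolyF (f : ℝ → ℝ) : Prop := ∃ p : Polynomial ℝ, ∀ s, f s = p.eval s

lemma IsPolyF.mul {f g : ℝ → ℝ} (hf : IsPolyF f) (hg : IsPolyF g) : IsPolyF fun s => f s * g s := by
  obtain ⟨p, hp⟩ := hf; obtain ⟨q, hq⟩ := hg
  exact ⟨p*q, fun s => by simp [hp, hq]⟩

lemma IsPolyF.add {f g : ℝ → ℝ} (hf : IsPolyF f) (hg : IsPolyF g) : IsPolyF fun s => f s + g s := by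
  obtain ⟨p, hp⟩ := hf; obtain ⟨q, hq⟩ := hg
  exact ⟨p+q, fun s => by simp [hp, hq]⟩

lemma IsPolyF.const (c : ℝ) : IsPolyF fun _ => c := ⟨Polynomial.C c, fun s => by simp⟩
lemma IsPolyF.id' : IsPolyF fun s => s := ⟨Polynomial.X, fun s => by simp⟩

lemma IsPolyF.sum {f : ℕ → ℝ → ℝ} (hf : ∀ i, IsPolyF (f i)) (n : ℕ) :
    IsPolyF fun s => ∑ i ∈ Finset.range n, f i s := by
  choose p hp using hf
  exact ⟨∑ i ∈ Finset.range n, p i, fun s => by simp [hp, Polynomial.eval_finsetSum]⟩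

lemma IsPolyF.poch {f : ℝ → ℝ} (hf : IsPolyF f) (n : ℕ) : IsPolyF fun s => poch (f s) n := by
  induction n with
  | zero => simpa [poch_zero'] using IsPolyF.const 1
  | succ n ih => simpa [poch_succ'] using ih.mul (hf.add (IsPolyF.const n))

lemma isPolyF_aC (j : ℕ) : IsPolyF (aC j) := by
  cases j with
  | zero => exact IsPolyF.const 1
  | succ j =>
    exact (IsPolyF.id'.mul
      (((IsPolyF.id'.add (.const (j:ℝ))).add (.const 2)).poch j)).mul (.const ((j+1).factorial : ℝ)⁻¹)

lemma isPolyF_bC (j : ℕ) {f : ℝ → ℝ} (hf : IsPolyF f) : IsPolyF fun s => bC j (f s) := by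
  cases j with
  | zero => exact IsPolyF.const 1
  | succ j =>
    exact (((hf.add (.const (2*j))).add (.const 2)).mul
      ((hf.add (.const 1)).poch j)).mul (.const ((j+1).factorial : ℝ)⁻¹)

/-- the convolution -/
noncomputable def HC (m : ℕ) (w s : ℝ) : ℝ :=
  ∑ j ∈ Finset.range (m+1), (-1)^j * bC (m-j) (w+s+2*j) * aC j s

lemma HC_one (m : ℕ) (w s : ℝ) : HC (m+1) w (s+1) = HC (m+1) (w+1) s - HC m (w+1) (s+2) := by
  unfold HC
  rw [Finset.sum_range_succ', Finset.sum_range_succ' _ (m+1)]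
  rw [add_sub_right_comm, ← Finset.sum_sub_distrib]
  congr 1
  · apply Finset.sum_congr rfl
    intro j _
    rw [aC_rec, Nat.add_sub_add_right]
    push_cast
    rw [show w + (s+1) + 2*((j:ℝ)+1) = w+1+s+2*((j:ℝ)+1) by ring,
      show w + 1 + (s+2) + 2*(j:ℝ) = w+1+s+2*((j:ℝ)+1) by ring]
    ring
  · simp [aC]; ring_nf

lemma HC_two (m : ℕ) (w s : ℝ) : HC (m+1) (w+1) s = HC (m+1) w s + HC m (w+1) s := by
  unfold HC
  rw [Finset.sum_range_succ, Finset.sum_range_succ _ (m+1)]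
  rw [add_right_comm (∑ x ∈ Finset.range (m + 1), _), ← Finset.sum_add_distrib]
  congr 1
  · apply Finset.sum_congr rfl
    intro j hj
    obtain ⟨k, rfl⟩ : ∃ k, m = j + k := ⟨m - j, by simp at hj; omega⟩
    rw [show j + k + 1 - j = k+1 by omega, show j+k-j = k by omega,
      show w + 1 + s + 2*(j:ℝ) = (w+s+2*j)+1 by ring, bC_rec]
    ring
  · simp [bC]

lemma HC_eq (m : ℕ) (w s : ℝ) : HC m w s = bC m w := by
  induction m generalizing w s with
  | zero => simp [HC, bC, aC]
  | succ m ih =>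
    have per : ∀ s, HC (m+1) w (s+1) = HC (m+1) w s := fun s => by
      rw [HC_one, HC_two, ih, ih]; ring
    have h0 : HC (m+1) w 0 = bC (m+1) w := by
      unfold HC
      rw [Finset.sum_range_succ', Finset.sum_eq_zero]
      · simp [aC]
      · intro j _; simp [aC_zero]
    have hN : ∀ N : ℕ, HC (m+1) w N = bC (m+1) w := fun N => by
      induction N with
      | zero => simpa using h0
      | succ N ih => push_cast; rw [per, ih]
    have hp : IsPolyF (HC (m+1) w) := by
      unfold HC
      apply IsPolyF.sum
      intro j
      exact ((IsPolyF.const _).mul (isPolyF_bC _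
        (((IsPolyF.const w).add .id').add (.const _)))).mul (isPolyF_aC j)
    obtain ⟨p, hp⟩ := hp
    have : p = Polynomial.C (bC (m+1) w) := by
      apply Polynomial.eq_of_infinite_eval_eq
      apply Set.infinite_of_injective_forall_mem (Nat.cast_injective (R := ℝ))
      intro N
      simp [← hp, hN]
    rw [hp, this]; simp

/-- normalized Gegenbauer, expanded at one -/
noncomputable def Zs (lam : ℝ) (m : ℕ) (t : ℝ) : ℝ :=
  ∑ i ∈ Finset.range (m+1),
    (-4)^i * poch (lam+1) i / (i.factorial:ℝ) * bC (m-i) (2*lam+2*i) * ((1-t)/2)^i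

lemma jac_Zs {lam : ℝ} (h : 0 < lam) (m : ℕ) (t : ℝ) :
    ((m : ℝ) + lam) / lam * (poch (2 * lam) m / poch (lam + 1/2) m) *
    jacobiP m (lam - 1/2) (lam - 1/2) t = Zs lam m t := by
  unfold jacobiP Zs
  rw [← mul_assoc, Finset.mul_sum]
  apply Finset.sum_congr rfl
  intro j hj
  obtain ⟨k, rfl⟩ : ∃ k, m = j + k := ⟨m - j, by simp at hj; omega⟩
  rw [← mul_assoc]
  congr 1
  rw [show lam - 1/2 + 1 = lam + 1/2 by ring, show j+k-j = k by omega,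
    show ((j+k:ℕ):ℝ) + (lam - 1/2) + (lam-1/2) + 1 = 2*lam + ((j+k:ℕ):ℝ) by push_cast; ring]
  have p1 := (poch_pos' (show 0 < lam + 1/2 by linarith) (j+k)).ne'
  have p2 := (poch_pos' (show 0 < lam + 1/2 by linarith) j).ne'
  have f1 : ((j+k).factorial : ℝ) ≠ 0 := by exact_mod_cast (Nat.factorial_pos _).ne'
  have f2 : (j.factorial : ℝ) ≠ 0 := by exact_mod_cast (Nat.factorial_pos _).ne'
  have f3 : (k.factorial : ℝ) ≠ 0 := by exact_mod_cast (Nat.factorial_pos _).ne'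
  have e1 := poch_neg j k
  have e2 := bC_poch k (2*lam+2*j)
  have e3 := poch_add' (2*lam) (j+k) j
  have e4 : poch (2*lam) (j+k+j) = poch (2*lam) (2*j) * poch (2*lam+2*j) k := by
    rw [show j+k+j = 2*j+k by ring, poch_add']; push_cast; rfl
  have e5 := poch_dup lam j
  have e6 : poch lam j * (lam + j) = lam * poch (lam+1) j := by
    rw [← poch_succ', poch_succ_left]
  have e1' : poch (-((j+k : ℕ):ℝ)) j = (-1)^j * (j+k).factorial / k.factorial := by
    rw [← e1]; field_simp
  rw [e1']
  rw [e4] at e3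
  rw [show ((-4:ℝ))^j = (-1)^j * 4^j by rw [← mul_pow]; norm_num]
  push_cast at *
  have key : ((j:ℝ)+k+lam) * (poch (2*lam) (j+k) * poch (2*lam + ((j:ℝ)+k)) j)
     = lam * 4^j * poch (lam+1) j * poch (lam+1/2) j * k.factorial * bC k (2*lam+2*j) := by
    rw [← e3, e5]
    linear_combination (4^j * poch lam j * poch (lam+1/2) j / 2) * e2 +
      (4^j * poch (lam+1/2) j * k.factorial * bC k (2*lam+2*j)) * e6
  clear e1 e2 e3 e4 e5 e6 e1'
  generalize poch (lam+1/2) j = A at *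
  generalize poch (lam+1/2) (j+k) = A' at *
  generalize poch (lam+1) j = A1 at *
  generalize poch (2*lam) (j+k) = A2 at *
  generalize poch (2*lam+((j:ℝ)+k)) j = A3 at *
  generalize bC k (2*lam+2*j) = A4 at *
  field_simp
  linear_combination key

/-- coefficients for Chebyshev -/
noncomputable def eC (m i : ℕ) : ℝ := if i ≤ m then (-4)^i * bC (m-i) (2*i) else 0

lemma poch_one' (k : ℕ) : poch 1 k = k.factorial := by
  induction k with
  | zero => simp [poch_zero']
  | succ k ih => rw [poch_succ', ih, Nat.factorial_succ]; push_cast; ring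

lemma Zs_eC (m N : ℕ) (h : m + 1 ≤ N) (t : ℝ) :
    Zs 0 m t = ∑ i ∈ Finset.range N, eC m i * ((1-t)/2)^i := by
  rw [← Finset.sum_subset (Finset.range_mono h)]
  · apply Finset.sum_congr rfl
    intro i hi
    have : i ≤ m := by simp at hi; omega
    have f2 : (i.factorial : ℝ) ≠ 0 := by exact_mod_cast (Nat.factorial_pos _).ne'
    simp only [eC, this, if_true, zero_add, mul_zero, poch_one']
    rw [mul_div_cancel_right₀ _ f2]
  · intro i _ hi
    have : ¬ i ≤ m := by simp at hi; omega
    simp [eC, this]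

lemma bC_zero' (k : ℕ) : bC (k+1) 0 = 2 := by
  have f2 : ((k+1).factorial : ℝ) ≠ 0 := by exact_mod_cast (Nat.factorial_pos _).ne'
  simp only [bC, zero_add, poch_one']
  rw [div_eq_iff f2, Nat.factorial_succ]; push_cast; ring

lemma bC_dbl (k : ℕ) (w : ℝ) :
    bC (k+2) (w+2) = bC (k+2) w + 2 * bC (k+1) (w+2) - bC k (w+2) := by
  have h1 := bC_rec (k+1) (w+1)
  have h2 := bC_rec (k+1) w
  have h3 := bC_rec k (w+1)
  rw [show w+1+1 = w+2 by ring] at h1 h3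
  linarith

lemma eC_rec (m i : ℕ) : eC (m+2) (i+1) = 2 * eC (m+1) (i+1) - eC m (i+1) - 4 * eC (m+1) i := by
  rcases Nat.lt_or_ge i m with h | h
  · obtain ⟨k, rfl⟩ : ∃ k, m = i + 1 + k := ⟨m - i - 1, by omega⟩
    simp only [eC]
    rw [if_pos (by omega), if_pos (by omega), if_pos (by omega), if_pos (by omega)]
    rw [show i+1+k+2-(i+1) = k+2 by omega, show i+1+k+1-(i+1) = k+1 by omega,
      show i+1+k-(i+1) = k by omega, show i+1+k+1-i = k+2 by omega]
    have := bC_dbl k (2*i)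
    push_cast
    rw [show (2:ℝ)*((i:ℝ)+1) = 2*i+2 by ring, this, pow_succ]; ring
  · rcases Nat.eq_or_lt_of_le h with rfl | h
    · simp only [eC]
      rw [if_pos (by omega), if_pos (by omega), if_neg (by omega), if_pos (by omega)]
      rw [show m+2-(m+1) = 1 by omega, show m+1-(m+1) = 0 by omega, show m+1-m = 1 by omega]
      simp [bC, poch_zero', pow_succ]; ring
    · rcases Nat.eq_or_lt_of_le h with rfl | h
      · simp only [eC]
        rw [if_pos (by omega), if_neg (by omega), if_neg (by omega), if_pos (by omega)]
        simp [bC, pow_succ]; ring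
      · simp only [eC]
        rw [if_neg (by omega), if_neg (by omega), if_neg (by omega), if_neg (by omega)]
        simp

lemma eC_rec0 (m : ℕ) : eC (m+1+2) 0 = 2 * eC (m+1+1) 0 - eC (m+1) 0 := by
  simp [eC]; rw [bC_zero', bC_zero', bC_zero']; norm_num

lemma Zs0_rec (m : ℕ) (t : ℝ) : Zs 0 (m+1+2) t = 2 * t * Zs 0 (m+1+1) t - Zs 0 (m+1) t := by
  rw [Zs_eC (m+1+2) (m+5) (by omega), Zs_eC (m+1) (m+5) (by omega)]
  have h1 : 2 * t * Zs 0 (m+1+1) t = 2 * ∑ i ∈ Finset.range (m+5), eC (m+1+1) i * ((1-t)/2)^i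
     - 4 * ((1-t)/2) * ∑ i ∈ Finset.range (m+4), eC (m+1+1) i * ((1-t)/2)^i := by
    rw [← Zs_eC _ _ (by omega), ← Zs_eC _ _ (by omega)]; ring
  have sp : ∀ F : ℕ → ℝ, ∑ i ∈ Finset.range (m+5), F i = ∑ i ∈ Finset.range (m+4), F (i+1) + F 0 :=
    fun F => Finset.sum_range_succ' F (m+4)
  rw [h1, sp, sp, sp, eC_rec0]
  have h2 : ∑ k ∈ Finset.range (m + 4), eC (m + 1 + 2) (k + 1) * ((1 - t) / 2) ^ (k + 1)
     = 2 * ∑ k ∈ Finset.range (m + 4), eC (m + 1 + 1) (k + 1) * ((1 - t) / 2) ^ (k + 1)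
      - ∑ k ∈ Finset.range (m + 4), eC (m + 1) (k + 1) * ((1 - t) / 2) ^ (k + 1)
      - 4 * ((1-t)/2) * ∑ i ∈ Finset.range (m+4), eC (m+1+1) i * ((1-t)/2)^i := by
    simp only [Finset.mul_sum, ← Finset.sum_sub_distrib]
    apply Finset.sum_congr rfl
    intro k _
    rw [eC_rec]; ring
  rw [h2]; ring

lemma Zs0_T (m : ℕ) (t : ℝ) :
    Zs 0 (m+1) t = 2 * (Polynomial.Chebyshev.T ℝ ((m+1 : ℕ) : ℤ)).eval t := by
  induction m using Nat.twoStepInduction with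
  | zero =>
    simp [Zs, Finset.sum_range_succ, bC, poch_zero', poch_succ']; ring
  | one =>
    simp [Zs, Finset.sum_range_succ, bC, poch_zero', poch_succ', Nat.factorial]
    norm_num [Polynomial.Chebyshev.T_two]; ring
  | more m h1 h2 =>
    rw [show m+2+1 = m+1+2 by ring, Zs0_rec, h1, h2]
    have := Polynomial.Chebyshev.T_add_two ℝ ((m+1:ℕ):ℤ)
    push_cast at *
    rw [this]
    simp; ring

lemma Zm_Zs {lam : ℝ} (h : 0 ≤ lam) (m : ℕ) (t : ℝ) : Zm lam m t = Zs lam m t := by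
  rcases h.eq_or_lt with rfl | h
  · cases m with
    | zero => simp [Zm, Zs, poch_zero', bC]
    | succ m => rw [Zs0_T]; simp [Zm]
  · rw [Zm, if_neg h.ne', jac_Zs h]

lemma jacobiP_one (m : ℕ) (a b : ℝ) : jacobiP m a b 1 = poch (a+1) m / m.factorial := by
  unfold jacobiP
  rw [Finset.sum_eq_single 0]
  · simp [poch_zero']
  · intro j _ hj; simp [hj]
  · simp

lemma jac_ker {lam : ℝ} (h : 0 < lam) (m : ℕ) (t : ℝ) :
    jacobiP m (lam - 1/2) (lam - 1/2) 1 * jacobiP m (lam - 1/2) (lam - 1/2) t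
      / hJ m (lam - 1/2) (lam - 1/2) = Zs lam m t := by
  rw [← jac_Zs h, jacobiP_one, hJ]
  rw [show lam - 1/2 + 1 = lam + 1/2 by ring, show lam - 1/2 + (lam-1/2) + 2 = 2*lam+1 by ring,
    show lam - 1/2 + (lam-1/2) + (m:ℝ) + 1 = 2*lam+m by ring,
    show lam - 1/2 + (lam-1/2) + 2*(m:ℝ) + 1 = 2*lam+2*m by ring]
  have e : poch (2*lam) m * (2*lam+m) = 2*lam * poch (2*lam+1) m := by
    rw [← poch_succ', poch_succ_left]
  have p1 := (poch_pos' (show 0 < lam + 1/2 by linarith) m).ne'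
  have p2 := (poch_pos' (show 0 < 2*lam + 1 by linarith) m).ne'
  have f1 : (m.factorial : ℝ) ≠ 0 := by exact_mod_cast (Nat.factorial_pos _).ne'
  have hm : (0:ℝ) ≤ m := by positivity
  have q1 : 2*lam+m ≠ 0 := by positivity
  have q2 : 2*lam+2*m ≠ 0 := by positivity
  generalize poch (lam+1/2) m = A at *
  generalize poch (2*lam+1) m = B at *
  generalize poch (2*lam) m = D at *
  generalize jacobiP m (lam - 1/2) (lam - 1/2) t = J at *
  have : D = 2*lam*B/(2*lam+m) := by rw [← e]; field_simp
  rw [this]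
  field_simp
  ring

lemma beta_real {p q : ℝ} (hp : 0 < p) (hq : 0 < q) :
    ∫ u in (0:ℝ)..1, u^(p-1) * (1-u)^(q-1) = Gamma p * Gamma q / Gamma (p+q) := by
  have h := ProbabilityTheory.beta_eq_betaIntegralReal p q hp hq
  rw [ProbabilityTheory.beta] at h
  rw [h, Complex.betaIntegral]
  have : ∫ x in (0:ℝ)..1, (x:ℂ)^((p:ℂ)-1) * (1-(x:ℂ))^((q:ℂ)-1)
      = ((∫ u in (0:ℝ)..1, u^(p-1) * (1-u)^(q-1) : ℝ) : ℂ) := by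
    rw [← intervalIntegral.integral_ofReal]
    apply intervalIntegral.integral_congr
    intro x hx
    rw [uIcc_of_le zero_le_one] at hx
    simp only
    rw [Complex.ofReal_mul, Complex.ofReal_cpow hx.1, Complex.ofReal_cpow (by linarith [hx.2])]
    push_cast; rfl
  rw [this, Complex.ofReal_re]

lemma Gamma_poch {p : ℝ} (hp : 0 < p) (i : ℕ) : Gamma (p+i) = poch p i * Gamma p := by
  induction i with
  | zero => simp [poch_zero']
  | succ i ih =>
    push_cast
    rw [← add_assoc, Gamma_add_one (by positivity), ih, poch_succ']; ring

/-- normalising constant -/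
noncomputable def CB (p q : ℝ) : ℝ := 2 * (2^(p-1) * 2^(q-1)) * (Gamma p * Gamma q / Gamma (p+q))

lemma CB_pos {p q : ℝ} (hp : 0 < p) (hq : 0 < q) : 0 < CB p q := by
  have := Gamma_pos_of_pos hp
  have := Gamma_pos_of_pos hq
  have := Gamma_pos_of_pos (add_pos hp hq)
  unfold CB; positivity

lemma mom {p q : ℝ} (hp : 0 < p) (hq : 0 < q) (i l : ℕ) :
    ∫ z in (-1:ℝ)..1, ((1-z)/2)^i * ((1+z)/2)^l * ((1-z)^(p-1) * (1+z)^(q-1))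
      = CB p q * (poch p i * poch q l / poch (p+q) (i+l)) := by
  have h1 := beta_real (show 0 < p + i by positivity) (show 0 < q + l by positivity)
  have h2 := intervalIntegral.integral_comp_sub_div (a := -1) (b := 1)
    (fun u : ℝ => u^(p+i-1) * (1-u)^(q+l-1)) (c := 2) two_ne_zero (1/2)
  norm_num at h2
  have h3 : ∫ z in (-1:ℝ)..1, ((1-z)/2)^i * ((1+z)/2)^l * ((1-z)^(p-1) * (1+z)^(q-1))
     = ∫ z in (-1:ℝ)..1, (2^(p-1)*2^(q-1)) * ((1/2-z/2)^(p+i-1) * (1-(1/2-z/2))^(q+l-1)) := by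
    apply intervalIntegral.integral_congr_ae
    have n1 : ∀ᵐ z : ℝ, z ≠ 1 := by simp [ae_iff]
    filter_upwards [n1] with z hz hz'
    rw [uIoc_of_le (by norm_num)] at hz'
    have z1 : 0 < (1-z)/2 := by have := lt_of_le_of_ne hz'.2 hz; linarith
    have z2 : 0 < (1+z)/2 := by linarith [hz'.1]
    rw [show 1/2-z/2 = (1-z)/2 by ring, show 1-(1-z)/2 = (1+z)/2 by ring,
      show p+i-1 = (p-1)+i by ring, show q+l-1 = (q-1)+l by ring,
      rpow_add z1, rpow_add z2, rpow_natCast, rpow_natCast]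
    have w1 : (1-z)^(p-1) = 2^(p-1) * ((1-z)/2)^(p-1) := by
      rw [← mul_rpow (by norm_num) z1.le]; congr 1; ring
    have w2 : (1+z)^(q-1) = 2^(q-1) * ((1+z)/2)^(q-1) := by
      rw [← mul_rpow (by norm_num) z2.le]; congr 1; ring
    rw [w1, w2]; ring
  have hg := (Gamma_pos_of_pos (add_pos hp hq)).ne'
  have hpp := (poch_pos' (add_pos hp hq) (i+l)).ne'
  rw [h3, intervalIntegral.integral_const_mul]
  norm_num
  rw [h2, h1, show p + i + (q+l) = p+q+((i+l:ℕ):ℝ) by push_cast; ring,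
    Gamma_poch hp, Gamma_poch hq, Gamma_poch (add_pos hp hq), CB]
  field_simp

lemma mom_int {p q : ℝ} (hp : 0 < p) (hq : 0 < q) (i l : ℕ) :
    IntervalIntegrable (fun z : ℝ => ((1-z)/2)^i * ((1+z)/2)^l * ((1-z)^(p-1) * (1+z)^(q-1)))
      volume (-1) 1 := by
  apply intervalIntegral.intervalIntegrable_of_integral_ne_zero
  rw [mom hp hq]
  have := CB_pos hp hq
  have := poch_pos' hp i
  have := poch_pos' hq l
  have := poch_pos' (add_pos hp hq) (i+l)
  positivity

lemma mom2 {β : ℝ} (hβ : -(1/2) < β) (l : ℕ) :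
    ∫ z in (-1:ℝ)..1, ((1-z)/2)^l * (1-z^2)^β
      = CB (β+1) (β+1) * (poch (β+1) l / poch (2*β+2) l) := by
  have h := mom (show 0 < β+1 by linarith) (show 0 < β+1 by linarith) l 0
  simp only [pow_zero, mul_one, poch_zero', add_zero, add_sub_cancel_right] at h
  rw [show 2*β+2 = β+1+(β+1) by ring, ← h]
  apply intervalIntegral.integral_congr
  intro z hz
  rw [uIcc_of_le (by norm_num)] at hz
  simp only
  rw [← mul_rpow (by linarith [hz.2]) (by linarith [hz.1])]
  congr 2; ring

lemma mom2_int {β : ℝ} (hβ : -(1/2) < β) (l : ℕ) :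
    IntervalIntegrable (fun z : ℝ => ((1-z)/2)^l * (1-z^2)^β) volume (-1) 1 := by
  apply intervalIntegral.intervalIntegrable_of_integral_ne_zero
  rw [mom2 hβ]
  have := CB_pos (show 0 < β+1 by linarith) (show 0 < β+1 by linarith)
  have := poch_pos' (show 0 < β+1 by linarith) l
  have := poch_pos' (show 0 < 2*β+2 by linarith) l
  positivity

/-- double integral predicate -/
def HasDI (f : ℝ → ℝ → ℝ) (v : ℝ) : Prop :=
  (∀ x, IntervalIntegrable (f x) volume (-1) 1) ∧
  IntervalIntegrable (fun x => ∫ y in (-1:ℝ)..1, f x y) volume (-1) 1 ∧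
  ∫ x in (-1:ℝ)..1, ∫ y in (-1:ℝ)..1, f x y = v

lemma HasDI.const_mul {f : ℝ → ℝ → ℝ} {v : ℝ} (h : HasDI f v) (c : ℝ) :
    HasDI (fun x y => c * f x y) (c * v) := by
  refine ⟨fun x => (h.1 x).const_mul c, ?_, ?_⟩
  · simp only [intervalIntegral.integral_const_mul]; exact h.2.1.const_mul c
  · simp only [intervalIntegral.integral_const_mul, h.2.2]

lemma HasDI.sum {f : ℕ → ℝ → ℝ → ℝ} {v : ℕ → ℝ} (s : Finset ℕ) (h : ∀ i ∈ s, HasDI (f i) (v i)) :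
    HasDI (fun x y => ∑ i ∈ s, f i x y) (∑ i ∈ s, v i) := by
  have e : ∀ x, ∫ y in (-1:ℝ)..1, ∑ i ∈ s, f i x y = ∑ i ∈ s, ∫ y in (-1:ℝ)..1, f i x y :=
    fun x => intervalIntegral.integral_finsetSum fun i hi => (h i hi).1 x
  refine ⟨fun x => ?_, ?_, ?_⟩
  · have := IntervalIntegrable.sum s fun i hi => (h i hi).1 x
    refine this.congr (fun y _ => ?_)
    simp
  · simp only [e]
    have := IntervalIntegrable.sum s fun i hi => (h i hi).2.1
    refine this.congr (fun y _ => ?_)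
    simp
  · simp only [e]
    rw [intervalIntegral.integral_finsetSum fun i hi => (h i hi).2.1]
    exact Finset.sum_congr rfl fun i hi => (h i hi).2.2

/-- the weight -/
noncomputable def W (lam β x y : ℝ) : ℝ := (1-x)^lam * (1+x)^(β-1/2) * (1-y^2)^β

lemma mono_DI {lam β : ℝ} (hl : 0 ≤ lam) (hβ : -(1/2) < β) (i l : ℕ) :
    HasDI (fun x y => ((1-x)/2)^i * ((1+x)/2)^l * ((1-y)/2)^l * W lam β x y)
      (CB (lam+1) (β+1/2) * CB (β+1) (β+1) *
        (poch (lam+1) i * poch (β+1/2) l / poch (lam+1+(β+1/2)) (i+l)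
          * (poch (β+1) l / poch (2*β+2) l))) := by
  have e : ∀ x y : ℝ, ((1-x)/2)^i * ((1+x)/2)^l * ((1-y)/2)^l * W lam β x y =
      (((1-x)/2)^i * ((1+x)/2)^l * ((1-x)^(lam+1-1) * (1+x)^(β+1/2-1))) *
        (((1-y)/2)^l * (1-y^2)^β) := by
    intro x y
    rw [W, show lam+1-1 = lam by ring, show β+1/2-1 = β-1/2 by ring]; ring
  simp only [e]
  have p1 : 0 < lam+1 := by linarith
  have p2 : 0 < β+1/2 := by linarith
  refine ⟨fun x => (mom2_int hβ l).const_mul _, ?_, ?_⟩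
  · simp only [intervalIntegral.integral_const_mul]
    exact (mom_int p1 p2 i l).mul_const _
  · simp only [intervalIntegral.integral_const_mul, intervalIntegral.integral_mul_const]
    rw [mom p1 p2, mom2 hβ]; ring

lemma Z_DI {lam β : ℝ} (hl : 0 ≤ lam) (hβ : -(1/2) < β) (m : ℕ) (c : ℝ) :
    HasDI (fun x y => Zs (lam+(β+1/2)) m ((1-x)/2*c + (1+x)/2*y) * W lam β x y)
      (CB (lam+1) (β+1/2) * CB (β+1) (β+1) * Zs lam m c) := by
  set κ := lam+(β+1/2) with hκ
  set K := CB (lam+1) (β+1/2) * CB (β+1) (β+1) with hK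
  have p2 : 0 < β+1/2 := by linarith
  have hκ0 : 0 < κ := by positivity
  -- expansion of the integrand
  have ef : ∀ x y : ℝ, Zs κ m ((1-x)/2*c + (1+x)/2*y) * W lam β x y =
      ∑ j ∈ Finset.range (m+1), ∑ i ∈ Finset.range (j+1),
        ((-4)^j * poch (κ+1) j / (j.factorial:ℝ) * bC (m-j) (2*κ+2*j) * (j.choose i) * ((1-c)/2)^i)
        * (((1-x)/2)^i * ((1+x)/2)^(j-i) * ((1-y)/2)^(j-i) * W lam β x y) := by
    intro x y
    rw [Zs, Finset.sum_mul]
    apply Finset.sum_congr rfl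
    intro j _
    rw [show (1-((1-x)/2*c + (1+x)/2*y))/2 = (1-x)/2*((1-c)/2) + (1+x)/2*((1-y)/2) by ring,
      add_pow, Finset.mul_sum, Finset.sum_mul]
    apply Finset.sum_congr rfl
    intro i _
    rw [mul_pow, mul_pow]; ring
  have main := HasDI.sum (Finset.range (m+1)) fun j _ => HasDI.sum (Finset.range (j+1)) fun i _ =>
    (mono_DI hl hβ i (j-i)).const_mul
      ((-4)^j * poch (κ+1) j / (j.factorial:ℝ) * bC (m-j) (2*κ+2*j) * (j.choose i) * ((1-c)/2)^i)
  simp only [ef]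
  convert main using 1
  -- now the algebraic identity
  rw [← hK]
  have hsw : ∀ F : ℕ → ℕ → ℝ, ∑ j ∈ Finset.range (m+1), ∑ i ∈ Finset.range (j+1), F j i
      = ∑ i ∈ Finset.range (m+1), ∑ l ∈ Finset.range (m-i+1), F (i+l) i := by
    intro F
    rw [Finset.sum_sigma', Finset.sum_sigma']
    refine Finset.sum_nbij' (fun a => ⟨a.2, a.1-a.2⟩) (fun a => ⟨a.1+a.2, a.1⟩) ?_ ?_ ?_ ?_ ?_
    · rintro ⟨j, i⟩ h; simp at h ⊢; omega
    · rintro ⟨j, i⟩ h; simp at h ⊢; omega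
    · rintro ⟨j, i⟩ h; simp at h ⊢; omega
    · rintro ⟨j, i⟩ h; simp at h ⊢
    · rintro ⟨j, i⟩ h; simp at h ⊢; rw [Nat.add_sub_cancel' (by omega)]
  rw [hsw, Zs, Finset.mul_sum]
  apply Finset.sum_congr rfl
  intro i hi
  rw [← HC_eq (m-i) (2*lam+2*i) (2*(β+1/2)), HC]
  rw [show K * ((-4)^i * poch (lam+1) i / (i.factorial:ℝ) * 
    (∑ j ∈ Finset.range (m-i+1), (-1)^j * bC (m-i-j) (2*lam+2*i+2*(β+1/2)+2*j) * aC j (2*(β+1/2)))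
     * ((1-c)/2)^i) = (K * ((-4)^i * poch (lam+1) i / (i.factorial:ℝ) * ((1-c)/2)^i)) *
    (∑ j ∈ Finset.range (m-i+1), (-1)^j * bC (m-i-j) (2*lam+2*i+2*(β+1/2)+2*j) * aC j (2*(β+1/2)))
    by ring, Finset.mul_sum]
  apply Finset.sum_congr rfl
  intro l hl'
  rw [show m - (i+l) = m-i-l by omega, show i + l - i = l by omega,
    show lam+1+(β+1/2) = κ+1 by rw [hκ]; ring,
    show 2*κ+2*((i+l:ℕ):ℝ) = 2*lam+2*i+2*(β+1/2)+2*l by rw [hκ]; push_cast; ring]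
  have ea := aC_poch l (2*(β+1/2))
  rw [poch_dup, show β+1/2+1/2 = β+1 by ring, show 2*(β+1/2)+1 = 2*β+2 by ring] at ea
  have q1 := (poch_pos' (show 0 < κ+1 by linarith) (i+l)).ne'
  have q2 := (poch_pos' (show 0 < 2*β+2 by linarith) l).ne'
  have f1 : (i.factorial : ℝ) ≠ 0 := by exact_mod_cast (Nat.factorial_pos _).ne'
  have f2 : (l.factorial : ℝ) ≠ 0 := by exact_mod_cast (Nat.factorial_pos _).ne'
  have f3 : ((i+l).factorial : ℝ) ≠ 0 := by exact_mod_cast (Nat.factorial_pos _).ne'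
  have ch : (((i+l).choose i : ℕ) : ℝ) * i.factorial * l.factorial = (i+l).factorial := by
    have := Nat.choose_mul_factorial_mul_factorial (Nat.le_add_right i l)
    rw [Nat.add_sub_cancel_left] at this
    exact_mod_cast this
  have ch' : (((i+l).choose i : ℕ) : ℝ) = (i+l).factorial / (i.factorial * l.factorial) := by
    rw [← ch]; field_simp
  rw [ch']
  have ea' : aC l (2*(β+1/2)) =
      4^l * poch (β+1/2) l * poch (β+1) l / (poch (2*β+2) l * l.factorial) := by
    rw [ea, eq_div_iff (mul_ne_zero q2 f2)]; ring
  rw [ea', pow_add, show ((-4:ℝ))^l = (-1)^l * 4^l by rw [← mul_pow]; norm_num]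
  generalize bC (m-i-l) (2*lam+2*i+2*(β+1/2)+2*l) = B0
  generalize poch (κ+1) (i+l) = B1 at *
  generalize poch (2*β+2) l = B2 at *
  generalize poch (β+1/2) l = B3 at *
  generalize poch (β+1) l = B4 at *
  generalize poch (lam+1) i = B5 at *
  field_simp

/-- for `β > -1/2`, the reproducing kernel on the surface of the paraboloid
is an integral of the reproducing kernel on the parabolic domain. -/
theorem stmt8 (d : ℕ) (hd : 2 ≤ d) (β γ : ℝ) (hβ : -(1/2) < β) (hγ : -1 < γ) (n : ℕ)
    (ξ η : Euc d) (hξ : ‖ξ‖ = 1) (hη : ‖η‖ = 1)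
    (t s : ℝ) (ht : t ∈ Set.Ioc (0:ℝ) 1) (hs : s ∈ Set.Ioc (0:ℝ) 1) :
    PnV0 d β γ n t s ⟪ξ, η⟫ =
      τβ d β * ∫ z₁ in (-1:ℝ)..1, ∫ z₂ in (-1:ℝ)..1,
        PnU γ (β + ((d : ℝ) - 1)/2) n (Real.sqrt t, t)
            (Real.sqrt s * ((1 - z₁)/2 * ⟪ξ, η⟫ + (1 + z₁)/2 * z₂), s) *
          ((1 - z₁) ^ (((d : ℝ) - 2)/2) * (1 + z₁) ^ (β - 1/2) * (1 - z₂ ^ 2) ^ β) := by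
  have hd' : (2:ℝ) ≤ d := by exact_mod_cast hd
  set c : ℝ := ⟪ξ, η⟫ with hc
  set lam : ℝ := ((d:ℝ)-2)/2 with hlam
  have hl : 0 ≤ lam := by rw [hlam]; linarith
  have hb : β + ((d:ℝ)-1)/2 = lam + (β+1/2) := by rw [hlam]; ring
  have hκ : 0 < lam + (β+1/2) := by linarith
  have st := (Real.sqrt_pos.2 ht.1).ne'
  have ss := (Real.sqrt_pos.2 hs.1).ne'
  have hK : CB (lam+1) (β+1/2) * CB (β+1) (β+1) ≠ 0 :=
    (mul_pos (CB_pos (by linarith) (by linarith)) (CB_pos (by linarith) (by linarith))).ne'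
  have hτ : τβ d β = (CB (lam+1) (β+1/2) * CB (β+1) (β+1))⁻¹ := by
    have h := (mono_DI hl hβ 0 0).2.2
    simp only [pow_zero, one_mul, poch_zero', add_zero, div_one, mul_one, W] at h
    rw [τβ, h]
  set D : ℕ → ℝ := fun m =>
    jacobiP (n - m) ((m : ℝ) + β + ((d : ℝ) - 1) / 2) γ (1 - 2 * t) *
      jacobiP (n - m) ((m : ℝ) + β + ((d : ℝ) - 1) / 2) γ (1 - 2 * s) / hV0 d β γ m n *
      (Real.sqrt t) ^ m * (Real.sqrt s) ^ m with hD
  have hL : PnV0 d β γ n t s c = ∑ m ∈ Finset.range (n+1), D m * Zs lam m c := by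
    rw [PnV0]
    exact Finset.sum_congr rfl fun m _ => by rw [Zm_Zs hl]
  have hU : ∀ x y : ℝ, PnU γ (β + ((d : ℝ) - 1)/2) n (Real.sqrt t, t)
            (Real.sqrt s * ((1 - x)/2 * c + (1 + x)/2 * y), s) *
          ((1 - x) ^ lam * (1 + x) ^ (β - 1/2) * (1 - y ^ 2) ^ β)
      = ∑ m ∈ Finset.range (n+1), D m *
          (Zs (lam+(β+1/2)) m ((1-x)/2*c + (1+x)/2*y) * W lam β x y) := by
    intro x y
    rw [PnU, Finset.sum_mul]
    apply Finset.sum_congr rfl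
    intro m _
    rw [← jac_ker hκ, ← W]
    simp only [PknU, hknU, hD, hV0]
    rw [div_self st, mul_div_cancel_left₀ _ ss,
      show (m:ℝ) + β + ((d:ℝ)-1)/2 = β + ((d:ℝ)-1)/2 + m by ring, hb]
    simp only [div_eq_mul_inv, mul_inv]
    ring
  simp only [hU]
  rw [(HasDI.sum (Finset.range (n+1)) fun m _ => (Z_DI hl hβ m c).const_mul (D m)).2.2, hL, hτ,
    Finset.mul_sum]
  apply Finset.sum_congr rfl
  intro m _
  rw [mul_left_comm, inv_mul_cancel_left₀ hK]
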